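/- Let v : ℝ → ℝ be twice continuously differentiable with v''(x) + f(v(x)) = 0 for all x ≥ 0, v(0) = a, and −√(−2F(a)) < v'(0) < 0. Then there exists M₂ > 0 such that v'(x) < 0 for all x ∈ [0, M₂), v'(M₂) = 0, and 0 < v(x) < a for all x ∈ (0, M₂]. -/

import Mathlib

open Set Filter Topology

/-- The primitive `F(s) = ∫₀^s f(r) dr`. -/
noncomputable def F (f : ℝ → ℝ) (s : ℝ) : ℝ := ∫ r in (0:ℝ)..s, f r

/-- Bistable nonlinearity with balanced-positive integral. -/
def Bistable (f : ℝ → ℝ) (a : ℝ) : Prop :=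
  ContDiff ℝ 1 f ∧ 0 < a ∧ a < 1 ∧
  f 0 = 0 ∧ f a = 0 ∧ f 1 = 0 ∧
  (∀ s, 0 < s → s < a → f s < 0) ∧
  (∀ s, a < s → s < 1 → 0 < f s) ∧
  deriv f 0 < 0 ∧ 0 < deriv f a ∧ deriv f 1 < 0 ∧
  0 < ∫ s in (0:ℝ)..(1:ℝ), f s


/-- The primitive of a continuous function has that function as its derivative. -/
theorem hasDerivAt_F {f : ℝ → ℝ} (hf : Continuous f) (s : ℝ) : HasDerivAt (F f) (f s) s :=
  intervalIntegral.integral_hasDerivAt_right (hf.intervalIntegrable _ _)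
    hf.aestronglyMeasurable.stronglyMeasurableAtFilter hf.continuousAt

/-- Conservation of energy for solutions of `v'' + f(v) = 0` on the half-line. -/
theorem energy_eq {f v : ℝ → ℝ} (hf : Continuous f) (hv : Differentiable ℝ v)
    (hv' : Differentiable ℝ (deriv v))
    (heq : ∀ x : ℝ, 0 ≤ x → deriv (deriv v) x + f (v x) = 0) {x : ℝ} (hx : 0 ≤ x) :
    deriv v x ^ 2 / 2 + F f (v x) = deriv v 0 ^ 2 / 2 + F f (v 0) := by
  have hd : ∀ y, HasDerivAt (fun y => deriv v y ^ 2 / 2 + F f (v y))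
      (deriv v y * (deriv (deriv v) y + f (v y))) y := fun y => by
    have h1 := ((hv' y).hasDerivAt.pow 2).div_const 2
    have h2 := (hasDerivAt_F hf (v y)).comp y (hv y).hasDerivAt
    refine (h1.add h2).congr_deriv ?_
    push_cast
    ring
  refine constant_of_has_deriv_right_zero (f := fun y => deriv v y ^ 2 / 2 + F f (v y))
    (fun y _ => (hd y).continuousAt.continuousWithinAt)
    (fun y hy => ?_) x (right_mem_Icc.2 hx)
  have := (hd y).hasDerivWithinAt (s := Ici y)
  rwa [heq y hy.1, mul_zero] at this

/-- A continuous function that is negative at the left endpoint and never vanishes on an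
order-connected set is negative there. -/
theorem neg_of_ne_zero {g : ℝ → ℝ} (hg : Continuous g) {p x : ℝ} (hpx : p ≤ x) (hp : g p < 0)
    (hne : ∀ y ∈ Icc p x, g y ≠ 0) : g x < 0 := by
  by_contra! h
  obtain ⟨y, hy, hy0⟩ := intermediate_value_Icc hpx hg.continuousOn ⟨hp.le, h⟩
  exact hne y hy hy0

/-- A continuous function that is negative at `0` and vanishes somewhere on the half-line has a
first zero. -/
theorem exists_first_zero {g : ℝ → ℝ} (hg : Continuous g) (h0 : g 0 < 0)
    (hz : ∃ x, 0 ≤ x ∧ g x = 0) :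
    ∃ M, 0 < M ∧ (∀ x, 0 ≤ x → x < M → g x < 0) ∧ g M = 0 := by
  set S : Set ℝ := Ici 0 ∩ g ⁻¹' {0}
  have hbdd : BddBelow S := ⟨0, fun y hy => hy.1⟩
  have hmem : sInf S ∈ S :=
    (isClosed_Ici.inter (isClosed_singleton.preimage hg)).csInf_mem hz hbdd
  have hM : g (sInf S) = 0 := hmem.2
  refine ⟨sInf S, lt_of_le_of_ne hmem.1 fun h => ?_, fun x hx hxM => ?_, hM⟩
  · rw [← h] at hM
    exact h0.ne hM
  · exact neg_of_ne_zero hg hx h0 fun y hy hy0 =>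
      absurd (csInf_le hbdd ⟨hy.1, hy0⟩) (not_le.2 (hy.2.trans_lt hxM))

/-- A function whose derivative is at least `c > 0` on `[1, ∞)` is positive somewhere there. -/
theorem exists_pos_of_deriv_ge {g : ℝ → ℝ} (hg : Differentiable ℝ g) {c : ℝ} (hc : 0 < c)
    (h : ∀ x, 1 ≤ x → c ≤ deriv g x) : ∃ x, 1 ≤ x ∧ 0 < g x := by
  have hx : 0 ≤ |g 1| / c := by positivity
  refine ⟨1 + |g 1| / c + 1, by linarith, ?_⟩
  have hslope := (convex_Ici (1 : ℝ)).mul_sub_le_image_sub_of_le_deriv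
    hg.continuous.continuousOn hg.differentiableOn
    (fun x hx => h x (interior_subset hx)) 1 self_mem_Ici (1 + |g 1| / c + 1)
    (mem_Ici.2 (by linarith)) (by linarith)
  have hcalc : c * (1 + |g 1| / c + 1 - 1) = c + |g 1| := by field_simp; ring
  linarith [neg_abs_le (g 1)]

/-- A trajectory starting at `(a, v'(0))` strictly inside the homoclinic orbit
reaches its first critical point at a finite length `M₂`, with value in `(0,a)`. -/
theorem first_critical_point_inside_homoclinic (f : ℝ → ℝ) (a : ℝ) (hf : Bistable f a)
    (v : ℝ → ℝ) (hv : ContDiff ℝ 2 v)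
    (heq : ∀ x : ℝ, 0 ≤ x → deriv (deriv v) x + f (v x) = 0)
    (h0 : v 0 = a)
    (h'0lo : -Real.sqrt (-(2 * F f a)) < deriv v 0)
    (h'0hi : deriv v 0 < 0) :
    ∃ M₂ : ℝ, 0 < M₂ ∧
      (∀ x : ℝ, 0 ≤ x → x < M₂ → deriv v x < 0) ∧
      deriv v M₂ = 0 ∧
      (∀ x : ℝ, 0 < x → x ≤ M₂ → 0 < v x ∧ v x < a) := by
  obtain ⟨hfC, ha, -, -, -, -, hfneg, -⟩ := hf
  have hfc : Continuous f := hfC.continuous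
  have hdv : Differentiable ℝ v := hv.differentiable (by norm_num)
  have hdv' : Differentiable ℝ (deriv v) := hv.differentiable_deriv_two
  have hE : deriv v 0 ^ 2 / 2 + F f a < 0 := by
    have h1 : -deriv v 0 < Real.sqrt (-(2 * F f a)) := by linarith
    have h2 := (Real.lt_sqrt (by linarith)).1 h1
    linarith [neg_sq (deriv v 0)]
  have henergy : ∀ x, 0 ≤ x → F f (v x) ≤ deriv v 0 ^ 2 / 2 + F f a := fun x hx => by
    have := energy_eq hfc hdv hdv' heq hx
    rw [h0] at this
    linarith [sq_nonneg (deriv v x)]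
  have hF0 : F f 0 = 0 := intervalIntegral.integral_same
  have hpos : ∀ x, 0 ≤ x → 0 < v x := fun x hx => by
    have := neg_of_ne_zero (g := fun y => -v y) hdv.continuous.neg hx (by simpa [h0] using ha)
      fun y hy hy0 => by
        have := henergy y hy.1
        rw [neg_eq_zero.1 hy0, hF0] at this
        linarith
    linarith
  have hanti : ∀ M, (∀ x, 0 ≤ x → x < M → deriv v x < 0) → StrictAntiOn v (Icc 0 M) :=
    fun M hM => strictAntiOn_of_deriv_neg (convex_Icc 0 M) hdv.continuous.continuousOn
      fun x hx => by
        rw [interior_Icc] at hx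
        exact hM x hx.1.le hx.2
  have hzero : ∃ x, 0 ≤ x ∧ deriv v x = 0 := by
    by_contra! hne
    have hneg : ∀ x, 0 ≤ x → deriv v x < 0 := fun x hx =>
      neg_of_ne_zero hdv'.continuous hx h'0hi fun y hy => hne y hy.1
    have hlt : ∀ x y, 0 ≤ x → x < y → v y < v x := fun x y hx hxy =>
      hanti y (fun z hz _ => hneg z hz) ⟨hx, hxy.le⟩ ⟨hx.trans hxy.le, le_rfl⟩ hxy
    obtain ⟨δ, hδ, hδv⟩ : ∃ δ > 0, ∀ x, 0 ≤ x → δ ≤ v x := by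
      have hcont : ContinuousAt (F f) 0 := (hasDerivAt_F hfc 0).continuousAt
      obtain ⟨δ, hδ, h⟩ := Metric.eventually_nhds_iff.1
        (hcont.eventually (lt_mem_nhds (hE.trans_eq hF0.symm)))
      refine ⟨δ, hδ, fun x hx => ?_⟩
      by_contra! hxδ
      refine absurd (henergy x hx) (not_le.2 (h ?_))
      rwa [Real.dist_eq, sub_zero, abs_of_pos (hpos x hx)]
    have hv1 : v 1 < a := h0 ▸ hlt 0 1 le_rfl one_pos
    obtain ⟨s, hs, hmax⟩ := isCompact_Icc.exists_isMaxOn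
      (nonempty_Icc.2 (hδv 1 zero_le_one)) hfc.continuousOn
    have hc : 0 < -f s := neg_pos.2 (hfneg s (hδ.trans_le hs.1) (hs.2.trans_lt hv1))
    obtain ⟨x, hx, hxpos⟩ := exists_pos_of_deriv_ge hdv' hc fun x hx => by
      have hx0 : 0 ≤ x := zero_le_one.trans hx
      have hle : v x ≤ v 1 := by
        rcases hx.eq_or_lt with rfl | h
        · exact le_rfl
        · exact (hlt 1 x zero_le_one h).le
      have hfx : f (v x) ≤ f s := hmax ⟨hδv x hx0, hle⟩
      linarith [heq x hx0]
    exact absurd hxpos (hneg x (zero_le_one.trans hx)).not_gt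
  obtain ⟨M, hM, hMneg, hM0⟩ := exists_first_zero hdv'.continuous h'0hi hzero
  exact ⟨M, hM, hMneg, hM0, fun x hx hxM => ⟨hpos x hx.le,
    h0 ▸ hanti M hMneg ⟨le_rfl, hM.le⟩ ⟨hx.le, hxM⟩ hx⟩⟩
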